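/- For Q as in the context, define C₋(u) := lim_{ε→0⁺} ∫_ℝ Q̂'(−v) · Q̂'(v−u)/(v + iε) dv for u ∈ ℝ (this limit exists and equals −2πi ∫_ℝ Q(x)Q'(x)e^{iux} dx). Then lim_{ε→0⁺} ∫_ℝ (Q̂'(u)/(u + iε)) · C₋(u) du = −(2π)²/6 (this is the evaluation of the constant C̃₋). -/

import Mathlib

open MeasureTheory Filter

/-- The Fourier transform of `Q'`: `Q̂'(k) = ∫ Q'(x) e^{−ikx} dx`. -/
noncomputable def QhatD (Q : ℝ → ℝ) (k : ℝ) : ℂ :=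
  ∫ x : ℝ, ((deriv Q x : ℝ) : ℂ) * Complex.exp (-Complex.I * (k : ℂ) * (x : ℂ))

/-- The constant `C₋(u) = −2πi ∫ Q(x)Q'(x)e^{iux} dx`. -/
noncomputable def Cminus (Q : ℝ → ℝ) (u : ℝ) : ℂ :=
  -2 * (Real.pi : ℂ) * Complex.I *
    ∫ x : ℝ, ((Q x * deriv Q x : ℝ) : ℂ) * Complex.exp (Complex.I * (u : ℂ) * (x : ℂ))

open scoped FourierTransform SchwartzMap Topology

/-- The one-sided exponential `t ↦ e^{εt} 1_{t ≤ 0}`. -/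
noncomputable def leftExp (ε : ℝ) : ℝ → ℂ :=
  (Set.Iic (0 : ℝ)).indicator fun t => Complex.exp (ε * t)

theorem integrable_leftExp {ε : ℝ} (hε : 0 < ε) : Integrable (leftExp ε) :=
  (integrable_indicator_iff measurableSet_Iic).2
    (integrableOn_exp_mul_complex_Iic (by simpa using hε) 0)

theorem fourier_leftExp {ε : ℝ} (hε : 0 < ε) (w : ℝ) :
    𝓕 (leftExp ε) w = 1 / (ε - 2 * Real.pi * w * Complex.I) := by
  have hre : 0 < ((ε : ℂ) - 2 * Real.pi * w * Complex.I).re := by simpa using hε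
  have h := integral_exp_mul_complex_Iic hre 0
  rw [Complex.ofReal_zero, mul_zero, Complex.exp_zero] at h
  rw [← h, ← integral_indicator measurableSet_Iic, Real.fourier_real_eq_integral_exp_smul]
  refine integral_congr_ae (.of_forall fun t => ?_)
  by_cases ht : t ∈ Set.Iic (0 : ℝ)
  · simp only [leftExp, Set.indicator_of_mem ht, smul_eq_mul, ← Complex.exp_add]
    congr 1
    push_cast
    ring
  · simp [leftExp, Set.indicator_of_notMem ht]

theorem norm_leftExp_le_one {ε : ℝ} (hε : 0 ≤ ε) (t : ℝ) : ‖leftExp ε t‖ ≤ 1 := by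
  by_cases ht : t ∈ Set.Iic (0 : ℝ)
  · rw [leftExp, Set.indicator_of_mem ht, ← Complex.ofReal_mul, ← Complex.ofReal_exp,
      Complex.norm_real, Real.norm_of_nonneg (Real.exp_pos _).le, Real.exp_le_one_iff]
    exact mul_nonpos_of_nonneg_of_nonpos hε ht
  · simp [leftExp, Set.indicator_of_notMem ht]

/-- Self-adjointness of the Fourier transform on integrable functions. -/
theorem integral_fourier_mul_eq_of_integrable {f g : ℝ → ℂ} (hf : Integrable f)
    (hg : Integrable g) : ∫ w, 𝓕 f w * g w = ∫ x, f x * 𝓕 g x := by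
  simpa using! VectorFourier.integral_fourierIntegral_smul_eq_flip (L := innerₗ ℝ)
    Real.continuous_fourierChar continuous_inner hf hg

theorem integrable_fourier_mul {k φ : ℝ → ℂ} (hk : Integrable k) (hφ : Integrable φ) :
    Integrable fun w => 𝓕 k w * φ w := by
  refine hφ.bdd_mul (c := ∫ t, ‖k t‖) ?_ (.of_forall fun w => ?_)
  · exact (VectorFourier.fourierIntegral_continuous (L := innerₗ ℝ)
      Real.continuous_fourierChar continuous_inner hk).aestronglyMeasurable
  · exact VectorFourier.norm_fourierIntegral_le_integral_norm _ _ _ _ _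

theorem fourier_exp_mul_fourierInv (g : 𝓢(ℝ, ℂ)) (x t : ℝ) :
    𝓕 (fun w : ℝ => Complex.exp (↑(-2 * Real.pi * w * x) * Complex.I) * 𝓕⁻ g w) t =
      g (x + t) := by
  have h : 𝓕 (𝓕⁻ g : 𝓢(ℝ, ℂ)) (x + t) = g (x + t) := by
    rw [FourierTransform.fourier_fourierInv_eq]
  rw [← h, SchwartzMap.fourier_coe, Real.fourier_real_eq_integral_exp_smul,
    Real.fourier_real_eq_integral_exp_smul]
  refine integral_congr_ae (.of_forall fun w => ?_)
  simp only [smul_eq_mul]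
  rw [← mul_assoc, ← Complex.exp_add]
  congr 2
  push_cast
  ring

/-- A triple product of Fourier transforms, with one factor inverted, integrates to a
convolution. -/
theorem integral_fourier_mul_fourier_mul_fourierInv {f k : ℝ → ℂ} (hf : Integrable f)
    (hk : Integrable k) (g : 𝓢(ℝ, ℂ)) :
    ∫ w, 𝓕 f w * (𝓕 k w * 𝓕⁻ g w) = ∫ x, f x * ∫ t, k t * g (x + t) := by
  rw [integral_fourier_mul_eq_of_integrable hf
    (integrable_fourier_mul hk (𝓕⁻ g).integrable)]
  refine integral_congr_ae (.of_forall fun x => ?_)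
  simp only
  congr 1
  have hφ : Integrable fun w : ℝ =>
      Complex.exp (↑(-2 * Real.pi * w * x) * Complex.I) * 𝓕⁻ g w := by
    refine (𝓕⁻ g).integrable.bdd_mul (c := 1) ?_ (.of_forall fun w => ?_)
    · exact Continuous.aestronglyMeasurable (by fun_prop)
    · rw [Complex.norm_exp_ofReal_mul_I]
  have := integral_fourier_mul_eq_of_integrable hk hφ
  simp only [fourier_exp_mul_fourierInv] at this
  rw [← this, Real.fourier_real_eq_integral_exp_smul]
  refine integral_congr_ae (.of_forall fun w => ?_)
  simp only [smul_eq_mul]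
  ring

theorem tendsto_integral_leftExp_mul {φ : ℝ → ℂ} (hφ : Integrable φ) :
    Tendsto (fun ε => ∫ t, leftExp ε t * φ t) (𝓝[>] 0) (𝓝 (∫ t in Set.Iic 0, φ t)) := by
  rw [← integral_indicator measurableSet_Iic]
  refine tendsto_integral_filter_of_dominated_convergence (fun t => ‖φ t‖) ?_ ?_ hφ.norm ?_
  · filter_upwards [self_mem_nhdsWithin] with ε hε
    exact (integrable_leftExp hε).1.mul hφ.1
  · filter_upwards [self_mem_nhdsWithin] with ε hε
    refine .of_forall fun t => ?_
    rw [norm_mul]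
    exact mul_le_of_le_one_left (norm_nonneg _) (norm_leftExp_le_one (le_of_lt hε) t)
  · refine .of_forall fun t => ?_
    by_cases ht : t ∈ Set.Iic (0 : ℝ)
    · simp only [leftExp, Set.indicator_of_mem ht]
      have : Continuous fun ε : ℝ => Complex.exp (ε * t) * φ t := by fun_prop
      simpa using (this.tendsto 0).mono_left nhdsWithin_le_nhds
    · simp [leftExp, Set.indicator_of_notMem ht]

theorem integral_Iic_comp_add_left (g : ℝ → ℂ) (x : ℝ) :
    ∫ t in Set.Iic 0, g (x + t) = ∫ y in Set.Iic x, g y := by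
  have h := (measurePreserving_add_left volume x).setIntegral_preimage_emb
    (measurableEmbedding_addLeft x) g (Set.Iic x)
  rw [← h]
  congr 2
  ext t
  simp

theorem tendsto_integral_mul_integral_leftExp_mul {f : ℝ → ℂ} (hf : Integrable f)
    (g : 𝓢(ℝ, ℂ)) :
    Tendsto (fun ε => ∫ x, f x * ∫ t, leftExp ε t * g (x + t)) (𝓝[>] 0)
      (𝓝 (∫ x, f x * ∫ y in Set.Iic x, g y)) := by
  have hg : ∀ x, Integrable fun t => g (x + t) := fun x => g.integrable.comp_add_left x
  have hb : ∀ ε > 0, ∀ x, ‖∫ t, leftExp ε t * g (x + t)‖ ≤ ∫ t, ‖g t‖ := by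
    intro ε hε x
    rw [← integral_add_left_eq_self (fun t => ‖g t‖) x]
    refine norm_integral_le_of_norm_le (hg x).norm (.of_forall fun t => ?_)
    rw [norm_mul]
    exact mul_le_of_le_one_left (norm_nonneg _) (norm_leftExp_le_one hε.le t)
  refine tendsto_integral_filter_of_dominated_convergence
    (fun x => ‖f x‖ * ∫ t, ‖g t‖) ?_ ?_ (hf.norm.mul_const _) ?_
  · filter_upwards [self_mem_nhdsWithin] with ε hε
    refine hf.1.mul (Continuous.aestronglyMeasurable ?_)
    refine continuous_of_dominated (bound := fun t => ‖leftExp ε t‖ * ‖g.toBoundedContinuousFunction‖)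
      (fun x => (integrable_leftExp hε).1.mul (hg x).1) ?_
      ((integrable_leftExp hε).norm.mul_const _) (.of_forall fun t => by fun_prop)
    refine fun x => .of_forall fun t => ?_
    rw [norm_mul]
    gcongr
    exact g.toBoundedContinuousFunction.norm_coe_le_norm (x + t)
  · filter_upwards [self_mem_nhdsWithin] with ε hε
    refine .of_forall fun x => ?_
    rw [norm_mul]
    gcongr
    exact hb ε hε x
  · refine .of_forall fun x => Tendsto.const_mul _ ?_
    rw [← integral_Iic_comp_add_left]
    exact tendsto_integral_leftExp_mul (hg x)

/-- The `ε → 0⁺` limit of a pairing of Fourier transforms against `1 / (v + iε)`. -/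
theorem tendsto_integral_fourier_mul_fourierInv_div {f : ℝ → ℂ} (hf : Integrable f)
    (g : 𝓢(ℝ, ℂ)) :
    Tendsto (fun ε : ℝ => ∫ v : ℝ, 𝓕 f (v / (2 * Real.pi)) * 𝓕⁻ g (v / (2 * Real.pi)) /
        ((v : ℂ) + Complex.I * (ε : ℂ))) (𝓝[>] 0)
      (𝓝 (-2 * (Real.pi : ℂ) * Complex.I * ∫ x, f x * ∫ y in Set.Iic x, g y)) := by
  refine ((tendsto_integral_mul_integral_leftExp_mul hf g).const_mul _).congr' ?_
  filter_upwards [self_mem_nhdsWithin] with ε (hε : 0 < ε)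
  rw [← integral_fourier_mul_fourier_mul_fourierInv hf (integrable_leftExp hε)]
  have hpi : (Real.pi : ℂ) ≠ 0 := by exact_mod_cast Real.pi_ne_zero
  have h2 : |2 * Real.pi| = 2 * Real.pi := abs_of_pos Real.two_pi_pos
  have key := Measure.integral_comp_div
    (fun w : ℝ => -Complex.I * (𝓕 f w * (𝓕 (leftExp ε) w * 𝓕⁻ g w))) (2 * Real.pi)
  rw [h2, Complex.real_smul] at key
  refine Eq.trans ?_ (key.symm.trans (integral_congr_ae (.of_forall fun v => ?_)))
  · rw [integral_const_mul]
    push_cast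
    ring
  · have h1 : (v : ℂ) + Complex.I * ε ≠ 0 := fun h => by
      have := congrArg Complex.im h
      simp at this
      exact hε.ne' this
    have h3 : (ε : ℂ) - v * Complex.I ≠ 0 := fun h => by
      have := congrArg Complex.re h
      simp at this
      exact hε.ne' this
    have h4 : (2 * Real.pi * ((v / (2 * Real.pi) : ℝ) : ℂ)) = v := by
      push_cast
      field_simp
    have h5 : -Complex.I * (1 / (ε - v * Complex.I)) = 1 / (v + Complex.I * ε) := by
      rw [mul_one_div, div_eq_div_iff h3 h1]
      linear_combination (-(ε : ℂ)) * Complex.I_sq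
    simp only [fourier_leftExp hε, h4]
    linear_combination (𝓕 f (v / (2 * Real.pi)) * 𝓕⁻ g (v / (2 * Real.pi))) * h5

/-- The Fourier integral in the angular-frequency normalization. -/
theorem fourier_div_two_pi (f : ℝ → ℂ) (v : ℝ) :
    𝓕 f (v / (2 * Real.pi)) = ∫ x : ℝ, f x * Complex.exp (-Complex.I * v * x) := by
  have hpi : (Real.pi : ℂ) ≠ 0 := by exact_mod_cast Real.pi_ne_zero
  rw [Real.fourier_real_eq_integral_exp_smul]
  refine integral_congr_ae (.of_forall fun x => ?_)
  simp only [smul_eq_mul]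
  rw [mul_comm]
  congr 2
  push_cast
  field_simp

theorem fourierInv_div_two_pi (g : 𝓢(ℝ, ℂ)) (v : ℝ) :
    𝓕⁻ g (v / (2 * Real.pi)) = ∫ x : ℝ, g x * Complex.exp (Complex.I * v * x) := by
  rw [SchwartzMap.fourierInv_coe, Real.fourierInv_eq_fourier_neg, ← neg_div, fourier_div_two_pi]
  simp

section Cutoff

variable {Q : ℝ → ℝ} {a b : ℝ}

theorem hasCompactSupport_deriv_of_eventually_const (hQ0 : ∀ x : ℝ, x ≤ a → Q x = 0)
    (hQ1 : ∀ x : ℝ, b ≤ x → Q x = 1) : HasCompactSupport (deriv Q) := by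
  refine HasCompactSupport.intro (isCompact_Icc (a := a) (b := b)) fun x hx => ?_
  rw [Set.mem_Icc, not_and_or, not_le, not_le] at hx
  rcases hx with hx | hx
  · have : Q =ᶠ[𝓝 x] fun _ => 0 := by
      filter_upwards [Iio_mem_nhds hx] with y hy using hQ0 y (le_of_lt hy)
    simpa using this.deriv_eq
  · have : Q =ᶠ[𝓝 x] fun _ => 1 := by
      filter_upwards [Ioi_mem_nhds hx] with y hy using hQ1 y (le_of_lt hy)
    simpa using this.deriv_eq

/-- The integral of `Q^n Q'` up to `x`. -/
theorem integral_Iic_pow_mul_deriv (hQ : ContDiff ℝ (⊤ : ℕ∞) Q)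
    (hQ0 : ∀ x : ℝ, x ≤ a → Q x = 0) (hc : HasCompactSupport (deriv Q)) (n : ℕ) (x : ℝ) :
    ∫ y in Set.Iic x, Q y ^ n * deriv Q y = Q x ^ (n + 1) / (n + 1) := by
  have hd : Continuous (deriv Q) := hQ.continuous_deriv (by simp)
  have hi : Integrable fun y => Q y ^ n * deriv Q y :=
    ((hQ.continuous.pow n).mul hd).integrable_of_hasCompactSupport hc.mul_left
  have hlim : Tendsto (fun y => Q y ^ (n + 1) / ((n : ℝ) + 1)) atBot (𝓝 0) := by
    refine tendsto_const_nhds.congr' ?_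
    filter_upwards [eventually_le_atBot a] with y hy
    simp [hQ0 y hy]
  have h := integral_Iic_of_hasDerivAt_of_tendsto' (a := x)
    (f' := fun y => Q y ^ n * deriv Q y) (fun y _ => ?_) hi.integrableOn hlim
  · simpa using h
  · have := (((hQ.differentiable (by simp)) y).hasDerivAt.pow (n + 1)).div_const ((n : ℝ) + 1)
    refine this.congr_deriv ?_
    have : (n : ℝ) + 1 ≠ 0 := by positivity
    push_cast
    field_simp

/-- The total integral of `Q^n Q'`. -/
theorem integral_pow_mul_deriv (hQ : ContDiff ℝ (⊤ : ℕ∞) Q)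
    (hQ0 : ∀ x : ℝ, x ≤ a → Q x = 0) (hQ1 : ∀ x : ℝ, b ≤ x → Q x = 1)
    (hc : HasCompactSupport (deriv Q)) (n : ℕ) :
    ∫ y, Q y ^ n * deriv Q y = 1 / (n + 1) := by
  have hd : Continuous (deriv Q) := hQ.continuous_deriv (by simp)
  have hi : Integrable fun y => Q y ^ n * deriv Q y :=
    ((hQ.continuous.pow n).mul hd).integrable_of_hasCompactSupport hc.mul_left
  refine tendsto_nhds_unique
    ((aecover_Iic tendsto_id).integral_tendsto_of_countably_generated hi) ?_
  refine tendsto_const_nhds.congr' ?_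
  filter_upwards [eventually_ge_atTop b] with x hx
  simp [integral_Iic_pow_mul_deriv hQ hQ0 hc, hQ1 x hx]

end Cutoff

/-- `C₋(u)` is the limit of the `ε`-regularized integrals, and the evaluation of the
constant `C̃₋`: `lim_{ε→0⁺} ∫ (Q̂'(u)/(u+iε)) C₋(u) du = −(2π)²/6`. -/
theorem Ctilde_minus_eval (Q : ℝ → ℝ) (hQ : ContDiff ℝ (⊤ : ℕ∞) Q) (a b : ℝ)
    (ha : 0 < a) (hab : a < b)
    (hQ0 : ∀ x : ℝ, x ≤ a → Q x = 0) (hQ1 : ∀ x : ℝ, b ≤ x → Q x = 1) :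
    (∀ u : ℝ,
      Tendsto (fun ε : ℝ =>
          ∫ v : ℝ, QhatD Q (-v) * QhatD Q (v - u) / ((v : ℂ) + Complex.I * (ε : ℂ)))
        (nhdsWithin 0 (Set.Ioi 0)) (nhds (Cminus Q u))) ∧
    Tendsto (fun ε : ℝ =>
        ∫ u : ℝ, (QhatD Q u / ((u : ℂ) + Complex.I * (ε : ℂ))) * Cminus Q u)
      (nhdsWithin 0 (Set.Ioi 0)) (nhds (-(2 * (Real.pi : ℂ))^2 / 6)) := by
  have hc := hasCompactSupport_deriv_of_eventually_const hQ0 hQ1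
  have hd : ContDiff ℝ (⊤ : ℕ∞) (deriv Q) := (contDiff_infty_iff_deriv.1 hQ).2
  have hschwartz : ∀ n : ℕ, ∃ g : 𝓢(ℝ, ℂ), ∀ x, g x = ((Q x ^ n * deriv Q x : ℝ) : ℂ) := by
    intro n
    have hs : HasCompactSupport fun x => ((Q x ^ n * deriv Q x : ℝ) : ℂ) :=
      (hc.mul_left (f := fun x => Q x ^ n)).comp_left Complex.ofReal_zero
    exact ⟨hs.toSchwartzMap (Complex.ofRealCLM.contDiff.comp ((hQ.pow n).mul hd)), fun x => rfl⟩
  have hprim : ∀ (n : ℕ) (x : ℝ), ∫ y in Set.Iic x, ((Q y ^ n * deriv Q y : ℝ) : ℂ) =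
      ((Q x ^ (n + 1) / (n + 1) : ℝ) : ℂ) := fun n x => by
    rw [integral_complex_ofReal, integral_Iic_pow_mul_deriv hQ hQ0 hc]
  refine ⟨fun u => ?_, ?_⟩
  · obtain ⟨g, hg⟩ := hschwartz 0
    simp only [pow_zero, one_mul] at hg
    have hf : Integrable fun x : ℝ => ((deriv Q x : ℝ) : ℂ) * Complex.exp (Complex.I * u * x) := by
      refine Continuous.integrable_of_hasCompactSupport ?_ ?_
      · have := hd.continuous
        fun_prop
      · exact (hc.comp_left Complex.ofReal_zero).mul_right
    have hF : ∀ v : ℝ, QhatD Q (v - u) =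
        𝓕 (fun x : ℝ => ((deriv Q x : ℝ) : ℂ) * Complex.exp (Complex.I * u * x))
          (v / (2 * Real.pi)) := fun v => by
      rw [fourier_div_two_pi, QhatD]
      refine integral_congr_ae (.of_forall fun x => ?_)
      simp only [mul_assoc, ← Complex.exp_add]
      congr 2
      push_cast
      ring
    have hG : ∀ v : ℝ, QhatD Q (-v) = 𝓕⁻ g (v / (2 * Real.pi)) := fun v => by
      simp [fourierInv_div_two_pi, QhatD, hg]
    have hval : Cminus Q u = -2 * (Real.pi : ℂ) * Complex.I *
        ∫ x : ℝ, ((deriv Q x : ℝ) : ℂ) * Complex.exp (Complex.I * u * x) *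
          ∫ y in Set.Iic x, g y := by
      rw [Cminus]
      congr 1
      refine integral_congr_ae (.of_forall fun x => ?_)
      have := hprim 0 x
      simp only [pow_zero, one_mul, zero_add, pow_one, Nat.cast_zero, div_one] at this
      simp only [hg, this]
      push_cast
      ring
    rw [hval]
    simp only [hF, hG, mul_comm (𝓕⁻ g _)]
    exact tendsto_integral_fourier_mul_fourierInv_div hf g
  · obtain ⟨g, hg⟩ := hschwartz 1
    simp only [pow_one] at hg
    have hf : Integrable fun x : ℝ => ((deriv Q x : ℝ) : ℂ) :=
      (hd.continuous.integrable_of_hasCompactSupport hc).ofReal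
    have hC : ∀ u, Cminus Q u =
        -2 * (Real.pi : ℂ) * Complex.I * 𝓕⁻ g (u / (2 * Real.pi)) := fun u => by
      simp only [Cminus, fourierInv_div_two_pi, hg]
    have hF : ∀ u, QhatD Q u = 𝓕 (fun x : ℝ => ((deriv Q x : ℝ) : ℂ)) (u / (2 * Real.pi)) :=
      fun u => by rw [fourier_div_two_pi, QhatD]
    have hval : ∫ x, ((deriv Q x : ℝ) : ℂ) * ∫ y in Set.Iic x, g y = 1 / 6 := by
      have h1 : ∀ x, ((deriv Q x : ℝ) : ℂ) * ∫ y in Set.Iic x, g y =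
          ((1 / 2 * (Q x ^ 2 * deriv Q x) : ℝ) : ℂ) := fun x => by
        have := hprim 1 x
        simp only [pow_one] at this
        simp only [hg, this]
        push_cast
        ring
      simp only [h1]
      rw [integral_complex_ofReal, integral_const_mul,
        integral_pow_mul_deriv hQ hQ0 hQ1 hc]
      norm_num
    have key := (tendsto_integral_fourier_mul_fourierInv_div hf g).const_mul
      (-2 * (Real.pi : ℂ) * Complex.I)
    rw [hval] at key
    convert key using 2 with ε
    · rw [← integral_const_mul]
      refine integral_congr_ae (.of_forall fun u => ?_)
      simp only [hC, hF]
      ring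
    · linear_combination (-(4 * (Real.pi : ℂ) ^ 2 / 6)) * Complex.I_sq
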